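/- For every n ∈ ℕ the expansion x^n = ∑_{k=0}^{n} a(n,k,t,q) F_k(x,t,q) holds in ℚ(q)[t,x]. In particular, a(2n,0,t,q) = C_n(t,q), so the linear functional L on ℚ(q)(t)-linear combinations of the polynomials F_k(x,t,q) determined by L(F_k(x,t,q)) = [k=0] satisfies L(x^{2n}) = C_n(t,q) and L(x^{2n+1}) = 0. -/

import Mathlib

open Finset Polynomial

/-- The field `ℚ(q)` of rational functions. -/
noncomputable abbrev K : Type := RatFunc ℚ

/-- The indeterminate `q`, viewed in `ℚ(q)`. -/
noncomputable def q : K := RatFunc.X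

/-- `[n] = (1 - q^n)/(1 - q)` in `ℚ(q)`. -/
noncomputable def qint (n : ℕ) : K := (1 - q ^ n) / (1 - q)

/-- The Gaussian binomial coefficient `[n choose k]_q` in `ℚ(q)`; it is `0` for `k < 0`
or `k > n`, with the convention `[m choose 0]_q = 1` for every integer `m`. -/
noncomputable def qbinom (n k : ℤ) : K :=
  if 0 ≤ k ∧ k ≤ n then
    ∏ i ∈ Finset.range k.toNat, (1 - q ^ (n - k + (i : ℤ) + 1)) / (1 - q ^ ((i : ℤ) + 1))
  else if k = 0 then 1 else 0

/-- The generalized q-Fibonacci polynomials `F_n(x,t,q)`, viewed as elements of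
`ℚ(q)[t][x]` (the outer variable is `x`, the inner one is `t`). -/
noncomputable def genF (n : ℕ) : Polynomial (Polynomial K) :=
  if n % 2 = 0 then
    ∑ k ∈ Finset.range (n / 2 + 1),
      Polynomial.C (((-1 : K) ^ k * q ^ (k * (k - 1) / 2)) •
        ∑ j ∈ Finset.range (k + 1),
          Polynomial.C (qbinom ((n / 2 : ℕ) - (j : ℤ)) ((k : ℤ) - j) *
              qbinom ((n / 2 : ℕ) - (k : ℤ) + j - 1) j * q ^ ((n / 2 - k + 1) * j)) *
            Polynomial.X ^ j) *
        Polynomial.X ^ (2 * (n / 2) - 2 * k)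
  else
    ∑ k ∈ Finset.range (n / 2 + 1),
      Polynomial.C (((-1 : K) ^ k * q ^ (k * (k - 1) / 2)) •
        ∑ j ∈ Finset.range (k + 1),
          Polynomial.C (qbinom ((n / 2 : ℕ) - (j : ℤ)) ((k : ℤ) - j) *
              qbinom ((n / 2 : ℕ) - (k : ℤ) + j) j * q ^ ((n / 2 - k + 1) * j)) *
            Polynomial.X ^ j) *
        Polynomial.X ^ (2 * (n / 2) + 1 - 2 * k)

/-- The connection coefficients `a(m, j, t, q) ∈ ℚ(q)[t]`. -/
noncomputable def coeffA (m j : ℤ) : Polynomial K :=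
  if 0 ≤ j ∧ j ≤ m ∧ (m - j) % 2 = 0 then
    if m % 2 = 0 then
      q ^ (-(m / 2 - j / 2)) •
        ∑ i ∈ Finset.range ((m / 2 - j / 2).toNat + 1),
          Polynomial.C (q ^ ((i : ℤ) ^ 2 + (j / 2 + 1) * i) *
            (qbinom (m / 2 - 1) i * qbinom (m / 2 + 1) ((i : ℤ) + j / 2 + 1) -
             qbinom (m / 2) i * qbinom (m / 2) ((i : ℤ) + j / 2 + 1))) * Polynomial.X ^ i
    else
      q ^ (-(m / 2 - j / 2)) •
        ∑ i ∈ Finset.range ((m / 2 - j / 2).toNat + 1),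
          Polynomial.C (q ^ ((i : ℤ) ^ 2 + (j / 2 + 1) * i) *
            (qbinom (m / 2) i * qbinom (m / 2 + 1) ((i : ℤ) + j / 2 + 1) -
             qbinom (m / 2 + 1) i * qbinom (m / 2) ((i : ℤ) + j / 2 + 1))) * Polynomial.X ^ i
  else 0

/-- The q-Narayana polynomial `C_n(t,q) ∈ ℚ(q)[t]`:
`C_0 = 1` and `C_n(t,q) = (1/[n]) ∑_{j=0}^{n−1} q^{j²+j} [n choose j]_q [n choose j+1]_q t^j`. -/
noncomputable def qNarayana (n : ℕ) : Polynomial K :=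
  if n = 0 then 1
  else (qint n)⁻¹ •
    ∑ j ∈ Finset.range n,
      Polynomial.C (q ^ (j ^ 2 + j) * qbinom n j * qbinom n ((j : ℤ) + 1)) * Polynomial.X ^ j

lemma q_ne_zero : q ≠ 0 := RatFunc.X_ne_zero

lemma one_sub_q_pow_ne_zero (k : ℕ) : 1 - q ^ (k + 1) ≠ 0 := by
  intro h
  have h1 : algebraMap ℚ[X] K (1 - X ^ (k + 1)) = 0 := by
    simpa [q] using h
  have h2 := (map_eq_zero_iff _ (RatFunc.algebraMap_injective ℚ)).1 h1
  simpa using congrArg (eval 0) h2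

/-- The Gaussian binomial coefficient on natural numbers, defined by the `q`-Pascal rule. -/
noncomputable def gauss : ℕ → ℕ → K
  | _, 0 => 1
  | 0, _ + 1 => 0
  | n + 1, k + 1 => gauss n k + q ^ (k + 1) * gauss n (k + 1)

@[simp] lemma gauss_zero_right (n : ℕ) : gauss n 0 = 1 := by cases n <;> rfl

@[simp] lemma gauss_zero_succ (k : ℕ) : gauss 0 (k + 1) = 0 := rfl

lemma gauss_succ_succ (n k : ℕ) :
    gauss (n + 1) (k + 1) = gauss n k + q ^ (k + 1) * gauss n (k + 1) := rfl

lemma gauss_eq_zero_of_lt {n k : ℕ} (h : n < k) : gauss n k = 0 := by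
  induction n generalizing k with
  | zero => obtain ⟨k, rfl⟩ := Nat.exists_eq_succ_of_ne_zero h.ne'; rfl
  | succ n ih =>
    obtain ⟨k, rfl⟩ := Nat.exists_eq_succ_of_ne_zero (by omega : k ≠ 0)
    rw [Nat.succ_eq_add_one, gauss_succ_succ, ih (by omega), ih (by omega)]
    simp

lemma one_sub_q_pow_mul_gauss_succ_succ (n k : ℕ) :
    (1 - q ^ (k + 1)) * gauss (n + 1) (k + 1) = (1 - q ^ (n + 1)) * gauss n k := by
  induction n generalizing k with
  | zero => cases k <;> simp [gauss_succ_succ]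
  | succ n ih =>
    cases k with
    | zero =>
      have h := ih 0
      simp only [gauss_zero_right, zero_add, pow_one] at h ⊢
      rw [gauss_succ_succ, gauss_zero_right]
      linear_combination q * h
    | succ k =>
      have h1 := ih (k + 1)
      have h2 := ih k
      have h3 := gauss_succ_succ n k
      rw [gauss_succ_succ (n + 1)]
      linear_combination q ^ (k + 2) * h1 + q * h2 - q * (1 - q ^ (n + 1)) * h3

/-- The absorption rule lowering the upper index, multiplied through by `q ^ k`. -/
lemma q_pow_mul_one_sub_mul_gauss (n k : ℕ) :
    q ^ k * (1 - q ^ (n + 1)) * gauss n k = (q ^ k - q ^ (n + 1)) * gauss (n + 1) k := by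
  cases k with
  | zero => simp
  | succ k =>
    linear_combination one_sub_q_pow_mul_gauss_succ_succ n k
      - (1 - q ^ (n + 1)) * gauss_succ_succ n k

lemma gauss_symm (a b : ℕ) : gauss (a + b) a = gauss (a + b) b := by
  induction a with
  | zero =>
    induction b with
    | zero => rfl
    | succ b ih =>
      have h := one_sub_q_pow_mul_gauss_succ_succ b b
      simp only [zero_add, gauss_zero_right] at ih ⊢
      rw [← ih] at h
      exact (mul_left_cancel₀ (one_sub_q_pow_ne_zero b) h).symm
  | succ a ih =>
    have h1 := one_sub_q_pow_mul_gauss_succ_succ (a + b) a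
    have h2 := q_pow_mul_one_sub_mul_gauss (a + b) b
    rw [ih] at h1
    rw [show a + 1 + b = a + b + 1 by ring]
    refine mul_left_cancel₀ (mul_ne_zero (pow_ne_zero b q_ne_zero) (one_sub_q_pow_ne_zero a)) ?_
    linear_combination q ^ b * h1 + h2

lemma qbinom_natCast (n k : ℕ) : qbinom n k = gauss n k := by
  induction k generalizing n with
  | zero => simp [qbinom]
  | succ k ih =>
    cases n with
    | zero => simp only [qbinom]; rw [if_neg (by omega), if_neg (by omega)]; rfl
    | succ n =>
      have h := one_sub_q_pow_mul_gauss_succ_succ n k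
      rw [← ih] at h
      rcases le_or_gt k n with hk | hk
      · rw [← mul_right_inj' (one_sub_q_pow_ne_zero k), h]
        simp only [qbinom]
        rw [if_pos (by omega), if_pos (by omega)]
        simp only [Int.toNat_natCast, prod_range_succ]
        have e : ∀ i : ℕ, ((n + 1 : ℕ) : ℤ) - ((k + 1 : ℕ) : ℤ) + i + 1 = n - k + i + 1 := by
          intro i; push_cast; ring
        simp only [e]
        have e1 : (n : ℤ) - k + k + 1 = ((n + 1 : ℕ) : ℤ) := by push_cast; ring
        have e2 : (k : ℤ) + 1 = ((k + 1 : ℕ) : ℤ) := by push_cast; ring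
        rw [e1, e2, zpow_natCast, zpow_natCast]
        have := one_sub_q_pow_ne_zero k
        field_simp
      · rw [gauss_eq_zero_of_lt (by omega)]
        simp only [qbinom]
        rw [if_neg (by omega), if_neg (by omega)]

lemma qbinom_eq_gauss {a b : ℤ} (n k : ℕ) (ha : a = n) (hb : b = k) :
    qbinom a b = gauss n k := by
  rw [ha, hb, qbinom_natCast]

lemma qbinom_sub_one_self (j : ℕ) : qbinom ((j : ℤ) - 1) j = if j = 0 then 1 else 0 := by
  simp only [qbinom]
  rw [if_neg (by omega)]
  simp

lemma coeff_sum_C_mul_X_pow {R : Type*} [Semiring R] (f : ℕ → R) (N j : ℕ) :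
    (∑ i ∈ range N, C (f i) * X ^ i).coeff j = if j < N then f j else 0 := by
  simp [coeff_X_pow]

/-- The substitution `t ↦ q t` on `ℚ(q)[t]`. -/
noncomputable def dilate : K[X] →+* K[X] := compRingHom (C q * X)

lemma coeff_dilate (p : K[X]) (j : ℕ) : (dilate p).coeff j = p.coeff j * q ^ j := by
  simp [dilate, comp_C_mul_X_coeff]

/-- The coefficients of the three-term recurrence of `genF`. -/
noncomputable def lam (k : ℕ) : K[X] :=
  if k % 2 = 0 then C (q ^ (k / 2)) * X else C (q ^ (k / 2))

lemma lam_even (k : ℕ) : lam (2 * k) = C (q ^ k) * X := by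
  simp [lam]

lemma lam_odd (k : ℕ) : lam (2 * k + 1) = C (q ^ k) := by
  rw [lam, if_neg (by omega)]
  congr 3
  omega

/-- The coefficient of `x ^ (2 * m) * t ^ j` in `genF (2 * n)`. -/
noncomputable def evenCoeff (n m j : ℕ) : K :=
  if m + j ≤ n then
    (-1) ^ (n - m) * q ^ ((n - m).choose 2) *
      (gauss (n - j) m * (if m = 0 then (if j = 0 then 1 else 0) else gauss (m + j - 1) j) *
        q ^ ((m + 1) * j))
  else 0

/-- The coefficient of `x ^ (2 * m + 1) * t ^ j` in `genF (2 * n + 1)`. -/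
noncomputable def oddCoeff (n m j : ℕ) : K :=
  if m + j ≤ n then
    (-1) ^ (n - m) * q ^ ((n - m).choose 2) *
      (gauss (n - j) m * gauss (m + j) j * q ^ ((m + 1) * j))
  else 0

/-- The polynomial `genF (2 * n)` in the variable `x ^ 2`. -/
noncomputable def evenF (n : ℕ) : K[X][X] :=
  ∑ m ∈ range (n + 1), C (∑ j ∈ range (n + 1), C (evenCoeff n m j) * X ^ j) * X ^ m

/-- The polynomial `genF (2 * n + 1)`, divided by `x`, in the variable `x ^ 2`. -/
noncomputable def oddF (n : ℕ) : K[X][X] :=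
  ∑ m ∈ range (n + 1), C (∑ j ∈ range (n + 1), C (oddCoeff n m j) * X ^ j) * X ^ m

lemma coeff_coeff_evenF (n m j : ℕ) : ((evenF n).coeff m).coeff j = evenCoeff n m j := by
  rw [evenF, coeff_sum_C_mul_X_pow]
  split_ifs
  · rw [coeff_sum_C_mul_X_pow]
    split_ifs
    · rfl
    · rw [evenCoeff, if_neg (by omega)]
  · rw [evenCoeff, if_neg (by omega), coeff_zero]

lemma coeff_coeff_oddF (n m j : ℕ) : ((oddF n).coeff m).coeff j = oddCoeff n m j := by
  rw [oddF, coeff_sum_C_mul_X_pow]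
  split_ifs
  · rw [coeff_sum_C_mul_X_pow]
    split_ifs
    · rfl
    · rw [oddCoeff, if_neg (by omega)]
  · rw [oddCoeff, if_neg (by omega), coeff_zero]

lemma genF_even (n : ℕ) : genF (2 * n) = expand K[X] 2 (evenF n) := by
  rw [genF, if_pos (by omega), evenF, map_sum, ← sum_range_reflect,
    Nat.mul_div_cancel_left n two_pos]
  refine sum_congr rfl fun m hm => ?_
  have hm : m ≤ n := by simpa [Nat.lt_succ_iff] using hm
  have hk : n + 1 - 1 - m = n - m := by omega
  rw [hk, map_mul, expand_C, map_pow, expand_X, ← pow_mul,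
    show 2 * n - 2 * (n - m) = 2 * m by omega]
  congr 2
  ext j
  rw [coeff_smul, coeff_sum_C_mul_X_pow, coeff_sum_C_mul_X_pow, evenCoeff]
  by_cases hj : m + j ≤ n
  · obtain ⟨d, rfl⟩ := Nat.exists_eq_add_of_le hj
    have e1 : m + j + d - m = j + d := by omega
    have e2 : m + j + d - j = d + m := by omega
    have e3 : m + j + d - (j + d) = m := by omega
    rw [if_pos (by omega), if_pos (by omega), if_pos hj, smul_eq_mul, Nat.choose_two_right,
      qbinom_eq_gauss (d + m) d (by omega) (by omega), gauss_symm, e1, e2, e3]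
    congr 3
    split_ifs with h0 h1
    · subst h0 h1
      simp [qbinom]
    · subst h0
      rw [show ((0 + j + d : ℕ) : ℤ) - ((j + d : ℕ) : ℤ) + j - 1 = j - 1 by push_cast; ring,
        qbinom_sub_one_self, if_neg h1]
    · exact qbinom_eq_gauss _ _ (by omega) rfl
  · rw [if_neg (by omega), if_neg hj]
    simp

lemma genF_odd (n : ℕ) : genF (2 * n + 1) = X * expand K[X] 2 (oddF n) := by
  rw [genF, if_neg (by omega), oddF, map_sum, ← sum_range_reflect,
    show (2 * n + 1) / 2 = n by omega, mul_sum]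
  refine sum_congr rfl fun m hm => ?_
  have hm : m ≤ n := by simpa [Nat.lt_succ_iff] using hm
  have hk : n + 1 - 1 - m = n - m := by omega
  rw [hk, map_mul, expand_C, map_pow, expand_X, ← pow_mul,
    show 2 * n + 1 - 2 * (n - m) = 2 * m + 1 by omega, mul_left_comm, ← pow_succ']
  congr 2
  ext j
  rw [coeff_smul, coeff_sum_C_mul_X_pow, coeff_sum_C_mul_X_pow, oddCoeff]
  by_cases hj : m + j ≤ n
  · obtain ⟨d, rfl⟩ := Nat.exists_eq_add_of_le hj
    have e1 : m + j + d - m = j + d := by omega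
    have e2 : m + j + d - j = d + m := by omega
    have e3 : m + j + d - (j + d) = m := by omega
    rw [if_pos (by omega), if_pos (by omega), if_pos hj, smul_eq_mul, Nat.choose_two_right,
      qbinom_eq_gauss (d + m) d (by omega) (by omega), gauss_symm, e1, e2, e3,
      qbinom_eq_gauss (m + j) j (by omega) rfl]
  · rw [if_neg (by omega), if_neg hj]
    simp

lemma evenCoeff_succ_succ (n m j : ℕ) :
    evenCoeff (n + 1) (m + 1) j = oddCoeff n m j * q ^ j - q ^ n * evenCoeff n (m + 1) j := by
  by_cases h : m + j ≤ n
  · obtain ⟨d, rfl⟩ := Nat.exists_eq_add_of_le h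
    have e1 : m + j + d + 1 - (m + 1) = j + d := by omega
    have e2 : m + j + d + 1 - j = m + d + 1 := by omega
    have e3 : m + j + d - m = j + d := by omega
    have e4 : m + j + d - j = m + d := by omega
    have e5 : m + 1 + j - 1 = m + j := by omega
    simp only [evenCoeff, oddCoeff, e1, e2, e3, e4, e5, gauss_succ_succ, Nat.succ_ne_zero, if_false]
    rw [if_pos (by omega), if_pos (by omega)]
    cases d with
    | zero =>
      rw [if_neg (by omega), gauss_eq_zero_of_lt (by omega : m + 0 < m + 1)]
      ring
    | succ d =>
      have e6 : m + j + (d + 1) - (m + 1) = j + d := by omega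
      rw [if_pos (by omega), e6, ← add_assoc j d 1, Nat.choose_succ_succ' (j + d) 1,
        Nat.choose_one_right]
      ring
  · simp only [evenCoeff, oddCoeff]
    rw [if_neg (by omega), if_neg h, if_neg (by omega)]
    ring

lemma evenCoeff_succ_zero (n j : ℕ) :
    evenCoeff (n + 1) 0 j = - (q ^ n * evenCoeff n 0 j) := by
  by_cases h : j = 0
  · subst h
    simp [evenCoeff, Nat.choose_succ_succ' n 1]
    ring
  · simp [evenCoeff, h]

lemma oddCoeff_zero_right (n m : ℕ) : oddCoeff n m 0 = evenCoeff n m 0 := by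
  rcases m with _ | m <;> simp [oddCoeff, evenCoeff]

lemma oddCoeff_succ_succ (n m j : ℕ) :
    oddCoeff (n + 1) m (j + 1) =
      evenCoeff (n + 1) m (j + 1) * q ^ (j + 1) - q ^ (n + 1) * oddCoeff n m j := by
  by_cases h : m + j ≤ n
  · obtain ⟨d, rfl⟩ := Nat.exists_eq_add_of_le h
    have e1 : m + j + d + 1 - m = j + d + 1 := by omega
    have e2 : m + j + d + 1 - (j + 1) = m + d := by omega
    have e3 : m + j + d - m = j + d := by omega
    have e4 : m + j + d - j = m + d := by omega
    simp only [evenCoeff, oddCoeff, e1, e2, e3, e4]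
    have h' : m + (j + 1) ≤ m + j + d + 1 := by omega
    rw [if_pos h', if_pos h', if_pos h, Nat.choose_succ_succ' (j + d) 1, Nat.choose_one_right]
    cases m with
    | zero =>
      simp only [zero_add, gauss_succ_succ, if_true, Nat.succ_ne_zero, if_false,
        gauss_eq_zero_of_lt (Nat.lt_succ_self j)]
      ring
    | succ m =>
      have e5 : m + 1 + (j + 1) - 1 = m + 1 + j := by omega
      rw [if_neg (by omega), e5, ← add_assoc (m + 1) j 1, gauss_succ_succ]
      ring
  · simp only [evenCoeff, oddCoeff]
    rw [if_neg (by omega), if_neg (by omega), if_neg h]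
    ring

lemma evenF_succ (n : ℕ) :
    evenF (n + 1) = X * (oddF n).map dilate - C (C (q ^ n)) * evenF n := by
  ext m j
  rw [coeff_sub, coeff_C_mul, coeff_sub, coeff_C_mul, coeff_coeff_evenF, coeff_coeff_evenF]
  cases m with
  | zero => rw [evenCoeff_succ_zero, mul_coeff_zero]; simp
  | succ m => rw [evenCoeff_succ_succ, coeff_X_mul, coeff_map, coeff_dilate, coeff_coeff_oddF]

lemma oddF_succ (n : ℕ) :
    oddF (n + 1) = (evenF (n + 1)).map dilate - C (C (q ^ (n + 1)) * X) * oddF n := by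
  ext m j
  rw [coeff_sub, coeff_C_mul, coeff_sub, mul_assoc, coeff_C_mul, coeff_map, coeff_dilate,
    coeff_coeff_evenF, coeff_coeff_oddF]
  cases j with
  | zero => rw [oddCoeff_zero_right, mul_coeff_zero]; simp
  | succ j => rw [oddCoeff_succ_succ, coeff_X_mul, coeff_coeff_oddF]

lemma genF_zero : genF 0 = 1 := by
  simp [genF, qbinom]

lemma genF_one : genF 1 = X := by
  simp [genF, qbinom]

lemma genF_add_two (N : ℕ) :
    genF (N + 2) = X * (genF (N + 1)).map dilate - C (lam (N + 1)) * genF N := by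
  obtain ⟨n, rfl | rfl⟩ := Nat.even_or_odd' N
  · rw [lam_odd, genF_odd, genF_even, show 2 * n + 2 = 2 * (n + 1) by ring, genF_even, evenF_succ]
    simp only [Polynomial.map_mul, map_X, map_expand, map_sub, map_mul, expand_X, expand_C]
    ring
  · rw [show 2 * n + 1 + 2 = 2 * (n + 1) + 1 by ring, show 2 * n + 1 + 1 = 2 * (n + 1) by ring,
      lam_even, genF_odd, genF_odd, genF_even, oddF_succ]
    simp only [map_expand, map_sub, map_mul, expand_C]
    ring

lemma coeffA_eq_zero {m j : ℤ} (h : ¬ (0 ≤ j ∧ j ≤ m ∧ (m - j) % 2 = 0)) : coeffA m j = 0 :=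
  if_neg h

lemma coeff_coeffA_even (p k i : ℕ) :
    (coeffA ((2 * (p + 1) : ℕ) : ℤ) ((2 * k : ℕ) : ℤ)).coeff i =
      q ^ ((i : ℤ) ^ 2 + (k + 1) * i - (p + 1 - k)) *
        (gauss p i * gauss (p + 2) (i + k + 1) - gauss (p + 1) i * gauss (p + 1) (i + k + 1)) := by
  by_cases hk : k ≤ p + 1
  · have e1 : ((2 * (p + 1) : ℕ) : ℤ) / 2 = (p + 1 : ℕ) := by omega
    have e2 : ((2 * k : ℕ) : ℤ) / 2 = k := by omega
    rw [coeffA, if_pos (by omega), if_pos (by omega), e1, e2, coeff_smul, coeff_sum_C_mul_X_pow,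
      qbinom_eq_gauss p i (by omega) rfl, qbinom_eq_gauss (p + 2) (i + k + 1) (by omega) (by omega),
      qbinom_eq_gauss (p + 1) i (by omega) rfl,
      qbinom_eq_gauss (p + 1) (i + k + 1) (by omega) (by omega)]
    split_ifs with h
    · rw [smul_eq_mul, ← mul_assoc, ← zpow_add₀ q_ne_zero]
      congr 2
      push_cast
      ring
    · rw [gauss_eq_zero_of_lt (by omega : p + 2 < i + k + 1),
        gauss_eq_zero_of_lt (by omega : p + 1 < i + k + 1)]
      simp
  · rw [coeffA_eq_zero (by omega), gauss_eq_zero_of_lt (by omega : p + 2 < i + k + 1),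
      gauss_eq_zero_of_lt (by omega : p + 1 < i + k + 1)]
    simp

lemma coeff_coeffA_odd (n k i : ℕ) :
    (coeffA ((2 * n + 1 : ℕ) : ℤ) ((2 * k + 1 : ℕ) : ℤ)).coeff i =
      q ^ ((i : ℤ) ^ 2 + (k + 1) * i - (n - k)) *
        (gauss n i * gauss (n + 1) (i + k + 1) - gauss (n + 1) i * gauss n (i + k + 1)) := by
  by_cases hk : k ≤ n
  · have e1 : ((2 * n + 1 : ℕ) : ℤ) / 2 = n := by omega
    have e2 : ((2 * k + 1 : ℕ) : ℤ) / 2 = k := by omega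
    rw [coeffA, if_pos (by omega), if_neg (by omega), e1, e2, coeff_smul, coeff_sum_C_mul_X_pow,
      qbinom_eq_gauss n i rfl rfl, qbinom_eq_gauss (n + 1) (i + k + 1) (by omega) (by omega),
      qbinom_eq_gauss (n + 1) i (by omega) rfl,
      qbinom_eq_gauss n (i + k + 1) rfl (by omega)]
    split_ifs with h
    · rw [smul_eq_mul, ← mul_assoc, ← zpow_add₀ q_ne_zero]
      congr 2
      ring
    · rw [gauss_eq_zero_of_lt (by omega : n + 1 < i + k + 1),
        gauss_eq_zero_of_lt (by omega : n < i + k + 1)]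
      simp
  · rw [coeffA_eq_zero (by omega), gauss_eq_zero_of_lt (by omega : n + 1 < i + k + 1),
      gauss_eq_zero_of_lt (by omega : n < i + k + 1)]
    simp

lemma coeffA_zero_zero : coeffA 0 0 = 1 := by
  have h : 1 - q ≠ 0 := by simpa using one_sub_q_pow_ne_zero 0
  simp [coeffA, qbinom, div_self h]

lemma q_zpow_eq_mul {a b : ℤ} (c : ℕ) (h : a = b + c) : q ^ a = q ^ b * q ^ c := by
  rw [h, zpow_add₀ q_ne_zero, zpow_natCast]

lemma coeffA_even_zero (n : ℕ) :
    coeffA ((2 * n + 2 : ℕ) : ℤ) 0 = lam 1 * dilate (coeffA ((2 * n + 1 : ℕ) : ℤ) 1) := by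
  ext i
  have h1 := coeff_coeffA_even n 0 i
  have h2 := coeff_coeffA_odd n 0 i
  simp only [mul_zero, zero_add, Nat.cast_zero, Nat.cast_one, add_zero, sub_zero, one_mul] at h1 h2
  have h0 := lam_odd 0
  simp only [mul_zero, zero_add] at h0
  rw [show 2 * n + 2 = 2 * (n + 1) by ring, h1, h0, coeff_C_mul, coeff_dilate, h2]
  rw [gauss_succ_succ (n + 1) i, gauss_succ_succ n i,
    q_zpow_eq_mul (a := (i : ℤ) ^ 2 + i - n) (b := (i : ℤ) ^ 2 + i - (n + 1)) 1
      (by push_cast; ring)]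
  ring

lemma coeffA_even_succ (n k : ℕ) :
    coeffA ((2 * n + 2 : ℕ) : ℤ) ((2 * k + 2 : ℕ) : ℤ) =
      dilate (coeffA ((2 * n + 1 : ℕ) : ℤ) ((2 * k + 1 : ℕ) : ℤ)) +
        lam (2 * k + 3) * dilate (coeffA ((2 * n + 1 : ℕ) : ℤ) ((2 * k + 3 : ℕ) : ℤ)) := by
  ext i
  rw [show 2 * k + 3 = 2 * (k + 1) + 1 by ring, show 2 * k + 2 = 2 * (k + 1) by ring,
    show 2 * n + 2 = 2 * (n + 1) by ring, lam_odd, coeff_add, coeff_C_mul, coeff_dilate,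
    coeff_dilate, coeff_coeffA_odd, coeff_coeffA_odd, coeff_coeffA_even]
  have e1 : q ^ ((i : ℤ) ^ 2 + (k + 1 + 1) * i - (n + 1 - (k + 1))) =
      q ^ ((i : ℤ) ^ 2 + (k + 1) * i - (n - k)) * q ^ i :=
    q_zpow_eq_mul i (by ring)
  have e2 : q ^ ((i : ℤ) ^ 2 + (k + 1 + 1) * i - (n - (k + 1))) =
      q ^ ((i : ℤ) ^ 2 + (k + 1) * i - (n - k)) * q ^ (i + 1) :=
    q_zpow_eq_mul (i + 1) (by push_cast; ring)
  push_cast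
  rw [e1, e2, show i + (k + 1) + 1 = i + k + 1 + 1 by ring, gauss_succ_succ (n + 1) (i + k + 1),
    gauss_succ_succ n (i + k + 1)]
  ring

lemma coeffA_odd_succ (n k : ℕ) :
    coeffA ((2 * n + 1 : ℕ) : ℤ) ((2 * k + 1 : ℕ) : ℤ) =
      dilate (coeffA ((2 * n : ℕ) : ℤ) ((2 * k : ℕ) : ℤ)) +
        lam (2 * k + 2) * dilate (coeffA ((2 * n : ℕ) : ℤ) ((2 * k + 2 : ℕ) : ℤ)) := by
  rcases n with _ | n
  · rcases k with _ | k
    · rw [coeffA_eq_zero (j := ((2 * 0 + 2 : ℕ) : ℤ)) (by omega)]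
      simp only [mul_zero, Nat.cast_zero, coeffA_zero_zero, map_one, map_zero, add_zero]
      ext i
      refine (coeff_coeffA_odd 0 0 i).trans ?_
      rcases i with _ | i <;> simp [gauss_succ_succ, coeff_one]
    · rw [coeffA_eq_zero (by omega), coeffA_eq_zero (by omega), coeffA_eq_zero (by omega)]
      simp
  ext i
  rw [show 2 * k + 2 = 2 * (k + 1) by ring, lam_even, coeff_add, mul_assoc, coeff_C_mul,
    coeff_dilate, coeff_coeffA_odd, coeff_coeffA_even]
  rcases i with _ | i
  · rw [mul_coeff_zero]
    simp
  rw [coeff_X_mul, coeff_dilate, coeff_coeffA_even]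
  have e : q ^ (((i : ℤ) + 1) ^ 2 + (k + 1) * ((i : ℤ) + 1) - (n + 1 - k)) =
      q ^ ((i : ℤ) ^ 2 + (k + 1 + 1) * i - (n + 1 - (k + 1))) * q ^ (k + 1 + i) :=
    q_zpow_eq_mul (k + 1 + i) (by push_cast; ring)
  push_cast
  rw [e, show i + 1 + k + 1 = i + (k + 1) + 1 by ring, gauss_succ_succ (n + 1) i,
    gauss_succ_succ n i]
  ring

lemma coeffA_succ_zero (N : ℕ) :
    coeffA ((N + 1 : ℕ) : ℤ) 0 = lam 1 * dilate (coeffA (N : ℤ) 1) := by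
  obtain ⟨n, rfl | rfl⟩ := Nat.even_or_odd' N
  · rw [coeffA_eq_zero (by omega), coeffA_eq_zero (by omega)]
    simp
  · exact coeffA_even_zero n

lemma coeffA_succ_succ (N k : ℕ) :
    coeffA ((N + 1 : ℕ) : ℤ) ((k + 1 : ℕ) : ℤ) =
      dilate (coeffA (N : ℤ) (k : ℤ)) +
        lam (k + 2) * dilate (coeffA (N : ℤ) ((k + 2 : ℕ) : ℤ)) := by
  by_cases hp : N % 2 = k % 2
  · obtain ⟨n, rfl | rfl⟩ := Nat.even_or_odd' N
    · obtain ⟨l, rfl⟩ : ∃ l, k = 2 * l := ⟨k / 2, by omega⟩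
      exact coeffA_odd_succ n l
    · obtain ⟨l, rfl⟩ : ∃ l, k = 2 * l + 1 := ⟨k / 2, by omega⟩
      exact coeffA_even_succ n l
  · rw [coeffA_eq_zero (by omega), coeffA_eq_zero (by omega), coeffA_eq_zero (by omega)]
    simp

lemma pow_eq_sum (N : ℕ) :
    (X : K[X][X]) ^ N = ∑ k ∈ range (N + 1), C (coeffA N k) * genF k := by
  induction N with
  | zero => simp [coeffA_zero_zero, genF_zero]
  | succ N ih =>
    have h := congrArg (fun p => X * p.map dilate) ih
    simp only [Polynomial.map_pow, map_X, ← pow_succ', Polynomial.map_sum, Polynomial.map_mul,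
      map_C, mul_sum] at h
    have hG : ∀ k, X * (genF (k + 1)).map dilate = genF (k + 2) + C (lam (k + 1)) * genF k := by
      intro k; rw [genF_add_two]; ring
    have hz : ∀ k, N < k → coeffA N k = 0 := fun k hk => coeffA_eq_zero (by omega)
    have hA : ∀ k : ℕ, C (coeffA ((N + 1 : ℕ) : ℤ) ((k + 1 : ℕ) : ℤ)) * genF (k + 1) =
        C (dilate (coeffA N k)) * genF (k + 1) +
          C (lam (k + 2)) * C (dilate (coeffA N ((k + 2 : ℕ) : ℤ))) * genF (k + 1) := by
      intro k; rw [coeffA_succ_succ, C_add, C_mul]; ring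
    have hL : ∀ k : ℕ, X * (C (dilate (coeffA N ((k + 1 : ℕ) : ℤ))) * (genF (k + 1)).map dilate) =
        C (dilate (coeffA N ((k + 1 : ℕ) : ℤ))) * genF (k + 1 + 1) +
          C (lam (k + 1)) * C (dilate (coeffA N ((k + 1 : ℕ) : ℤ))) * genF k := by
      intro k; rw [mul_left_comm, hG]; ring
    have hs : ∑ k ∈ range N, C (lam (k + 1)) * C (dilate (coeffA N ((k + 1 : ℕ) : ℤ))) * genF k =
        ∑ k ∈ range (N + 1),
          C (lam (k + 2)) * C (dilate (coeffA N ((k + 2 : ℕ) : ℤ))) * genF (k + 1) +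
            C (lam 1) * C (dilate (coeffA N 1)) * genF 0 := by
      have := sum_range_succ'
        (fun k => C (lam (k + 1)) * C (dilate (coeffA N ((k + 1 : ℕ) : ℤ))) * genF k) (N + 1)
      rw [sum_range_succ, sum_range_succ, hz (N + 1) (by omega), hz (N + 1 + 1) (by omega)] at this
      simpa [add_assoc, one_add_one_eq_two] using this
    rw [h, sum_range_succ' _ (N + 1), sum_congr rfl fun k _ => hA k, sum_add_distrib,
      sum_range_succ' _ N, sum_congr rfl fun k _ => hL k, sum_add_distrib, hs,
      sum_range_succ' (fun k => C (dilate (coeffA N k)) * genF (k + 1)) N, Nat.cast_zero,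
      coeffA_succ_zero, C_mul, genF_zero, genF_one, Polynomial.map_one]
    ring

lemma gauss_mul_sub_gauss_mul (p i : ℕ) :
    (1 - q ^ (p + 1)) * (gauss p i * gauss (p + 2) (i + 1) - gauss (p + 1) i * gauss (p + 1) (i + 1))
      = q ^ (p + 1) * (1 - q) * (gauss (p + 1) i * gauss (p + 1) (i + 1)) := by
  have h1 := q_pow_mul_one_sub_mul_gauss p i
  have h2 := q_pow_mul_one_sub_mul_gauss (p + 1) (i + 1)
  refine mul_left_cancel₀ (pow_ne_zero (i + 1) q_ne_zero) ?_
  linear_combination q * gauss (p + 2) (i + 1) * h1 - gauss (p + 1) i * h2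

lemma coeffA_eq_qNarayana (n : ℕ) : coeffA (2 * n) 0 = qNarayana n := by
  rcases n with _ | p
  · simp [qNarayana, coeffA_zero_zero]
  ext i
  have h := coeff_coeffA_even p 0 i
  have h0 : 1 - q ≠ 0 := by simpa using one_sub_q_pow_ne_zero 0
  have h1 := one_sub_q_pow_ne_zero p
  have h2 := gauss_mul_sub_gauss_mul p i
  have e : q ^ (i ^ 2 + i) = q ^ ((i : ℤ) ^ 2 + i - (p + 1)) * q ^ (p + 1) := by
    rw [← q_zpow_eq_mul (p + 1) (a := ((i ^ 2 + i : ℕ) : ℤ)) (by push_cast; ring), zpow_natCast]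
  simp only [mul_zero, zero_add, Nat.cast_zero, add_zero, sub_zero, one_mul, Nat.cast_mul,
    Nat.cast_ofNat] at h
  rw [h, qNarayana, if_neg (Nat.succ_ne_zero p), coeff_smul, coeff_sum_C_mul_X_pow, qbinom_natCast,
    qbinom_eq_gauss (p + 1) (i + 1) rfl (by push_cast; rfl), smul_eq_mul, qint, inv_div, e]
  have e2 : (if i < p + 1 then q ^ ((i : ℤ) ^ 2 + i - (p + 1)) * q ^ (p + 1) * gauss (p + 1) i *
      gauss (p + 1) (i + 1) else 0) = q ^ ((i : ℤ) ^ 2 + i - (p + 1)) * q ^ (p + 1) *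
        gauss (p + 1) i * gauss (p + 1) (i + 1) := by
    split_ifs with hi
    · rfl
    · rw [gauss_eq_zero_of_lt (by omega : p + 1 < i + 1), mul_zero]
  rw [e2, div_mul_eq_mul_div, eq_div_iff h1]
  linear_combination q ^ ((i : ℤ) ^ 2 + i - (p + 1)) * h2

/-- `x^n = ∑_{k=0}^n a(n,k,t,q) F_k(x,t,q)`, the constant term `a(2n,0,t,q)` is the
q-Narayana polynomial, and hence any `ℚ(q)[t]`-linear functional `L` with
`L(F_k(x,t,q)) = [k=0]` has moments `L(x^{2n}) = C_n(t,q)` and `L(x^{2n+1}) = 0`. -/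
theorem pow_eq_sum_genF :
    (∀ n : ℕ, (Polynomial.X : Polynomial (Polynomial K)) ^ n =
      ∑ k ∈ Finset.range (n + 1), Polynomial.C (coeffA n k) * genF k) ∧
    (∀ n : ℕ, coeffA (2 * n) 0 = qNarayana n) ∧
    (∀ L : Polynomial (Polynomial K) →ₗ[Polynomial K] Polynomial K,
      (∀ k : ℕ, L (genF k) = if k = 0 then 1 else 0) →
      ∀ n : ℕ, L ((Polynomial.X : Polynomial (Polynomial K)) ^ (2 * n)) = qNarayana n ∧
        L ((Polynomial.X : Polynomial (Polynomial K)) ^ (2 * n + 1)) = 0) := by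
  refine ⟨pow_eq_sum, coeffA_eq_qNarayana, fun L hL n => ?_⟩
  have hX : ∀ N : ℕ, L (X ^ N) = coeffA N 0 := by
    intro N
    rw [pow_eq_sum, map_sum, sum_range_succ']
    simp only [← smul_eq_C_mul, map_smul, hL]
    simp
  refine ⟨?_, ?_⟩
  · rw [hX, ← coeffA_eq_qNarayana]
    push_cast
    rfl
  · rw [hX, coeffA_eq_zero (by omega)]
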